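/- arXiv:2602.04131 — 5 statements merged into one kernel-verified Lean document; each statement's English description precedes it below -/
import Mathlib

section
/- Let a <= b be reals and let f : R -> R be twice continuously differentiable, strictly increasing, and concave on [a, b], with m = inf_{z in [a,b]} f'(z) > 0 and M = inf_{z in [a,b]} f''(z) <= 0. Set beta_eff = |M| / m. Let X be a random variable taking values in [a, b] almost surely. Then E[f(X)] lies in the range of f restricted to [a,b], and the certainty equivalent CE_f(X) = f^{-1}(E[f(X)]) satisfies CE_f(X) >= E[X] - (1/2) * beta_eff * Var(X). -/
open MeasureTheory ProbabilityTheory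

/-- Lower bound on the certainty equivalent: for a twice continuously differentiable,
strictly increasing, concave utility `f` on `[a, b]` with `m = inf f' > 0` and
`M = inf f'' ≤ 0`, and `X` taking values in `[a, b]` a.s., the expected utility
`E[f(X)]` lies in the range of `f` on `[a, b]`, and any `y ∈ [a, b]` with
`f(y) = E[f(X)]` (i.e. the certainty equivalent `f⁻¹(E[f(X)])`) satisfies
`y ≥ E[X] - (1/2) * (|M|/m) * Var(X)`. -/
theorem certainty_equivalent_lower_bound
    {Ω : Type*} [MeasureSpace Ω] [IsProbabilityMeasure (ℙ : Measure Ω)]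
    (a b : ℝ) (hab : a ≤ b)
    (f : ℝ → ℝ) (hf : ContDiffOn ℝ 2 f (Set.Icc a b))
    (hmono : StrictMonoOn f (Set.Icc a b))
    (hconc : ConcaveOn ℝ (Set.Icc a b) f)
    (m : ℝ) (hm : m = sInf (deriv f '' Set.Icc a b)) (hm0 : 0 < m)
    (M : ℝ) (hM : M = sInf (deriv (deriv f) '' Set.Icc a b)) (hM0 : M ≤ 0)
    (β : ℝ) (hβ : β = |M| / m)
    (X : Ω → ℝ) (hX : Measurable X) (hXab : ∀ᵐ ω ∂ℙ, X ω ∈ Set.Icc a b) :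
    (∫ ω, f (X ω)) ∈ f '' Set.Icc a b ∧
      ∀ y ∈ Set.Icc a b, f y = (∫ ω, f (X ω)) →
        (∫ ω, X ω) - (1 / 2) * β * variance X ℙ ≤ y := by
  classical
  have hfc : ContinuousOn f (Set.Icc a b) := hf.continuousOn
  have hbm : BddBelow (deriv f '' Set.Icc a b) := by
    by_contra h
    rw [Real.sInf_of_not_bddBelow h] at hm
    linarith
  have hmle : ∀ x ∈ Set.Icc a b, m ≤ deriv f x := fun x hx => by
    rw [hm]; exact csInf_le hbm ⟨x, hx, rfl⟩
  have hbM : ∀ x ∈ Set.Ioo a b, M ≤ deriv (deriv f) x := by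
    intro x hx
    have hlt : a < b := hx.1.trans hx.2
    have hu := uniqueDiffOn_Icc hlt
    have hc : ContinuousOn (iteratedDerivWithin 2 f (Set.Icc a b)) (Set.Icc a b) :=
      hf.continuousOn_iteratedDerivWithin (by norm_num) hu
    obtain ⟨c, hcb⟩ := (isCompact_Icc.image_of_continuousOn hc).bddBelow
    have hbdd : BddBelow (deriv (deriv f) '' Set.Icc a b) := by
      refine ⟨min c (min (deriv (deriv f) a) (deriv (deriv f) b)), ?_⟩
      rintro _ ⟨z, hz, rfl⟩
      rcases eq_or_lt_of_le hz.1 with h1 | h1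
      · subst h1; simp
      rcases eq_or_lt_of_le hz.2 with h2 | h2
      · subst h2; simp
      refine (min_le_left _ _).trans ?_
      have h3 := hcb ⟨z, hz, rfl⟩
      rw [iteratedDerivWithin_eq_iteratedDeriv hu (hf.contDiffAt (Icc_mem_nhds h1 h2)) hz,
        iteratedDeriv_succ, iteratedDeriv_one] at h3
      exact h3
    rw [hM]; exact csInf_le hbdd ⟨x, Set.Ioo_subset_Icc_self hx, rfl⟩
  have hfI : ContDiffOn ℝ 2 f (Set.Ioo a b) := hf.mono Set.Ioo_subset_Icc_self
  have hdI : ContDiffOn ℝ 1 (deriv f) (Set.Ioo a b) :=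
    hfI.deriv_of_isOpen isOpen_Ioo (by norm_num)
  have hd1 : ∀ x ∈ Set.Ioo a b, DifferentiableAt ℝ f x := fun x hx =>
    (hfI.differentiableOn (by norm_num)).differentiableAt (isOpen_Ioo.mem_nhds hx)
  have hd2 : ∀ x ∈ Set.Ioo a b, DifferentiableAt ℝ (deriv f) x := fun x hx =>
    (hdI.differentiableOn (by norm_num)).differentiableAt (isOpen_Ioo.mem_nhds hx)
  have hg1 : ∀ x ∈ Set.Ioo a b, HasDerivAt (fun x => f x - M / 2 * x ^ 2) (deriv f x - M * x) x := by
    intro x hx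
    have := (hd1 x hx).hasDerivAt.sub (((hasDerivAt_id x).pow 2).const_mul (M / 2))
    refine HasDerivAt.congr_deriv this ?_
    simp; ring
  have hg2 : ∀ x ∈ Set.Ioo a b, HasDerivAt (deriv (fun x => f x - M / 2 * x ^ 2))
      (deriv (deriv f) x - M) x := by
    intro x hx
    have h1 := (hd2 x hx).hasDerivAt.sub ((hasDerivAt_id x).const_mul M)
    have h2 : HasDerivAt (fun x => deriv f x - M * x) (deriv (deriv f) x - M) x := by
      refine HasDerivAt.congr_deriv h1 ?_
      simp
    refine h2.congr_of_eventuallyEq ?_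
    filter_upwards [isOpen_Ioo.mem_nhds hx] with z hz
    exact (hg1 z hz).deriv
  have hgc : ContinuousOn (fun x => f x - M / 2 * x ^ 2) (Set.Icc a b) :=
    hfc.sub (by fun_prop)
  have hconv : ConvexOn ℝ (Set.Icc a b) (fun x => f x - M / 2 * x ^ 2) := by
    refine convexOn_of_deriv2_nonneg (convex_Icc a b) hgc ?_ ?_ ?_
    · rw [interior_Icc]
      exact fun x hx => (hg1 x hx).differentiableAt.differentiableWithinAt
    · rw [interior_Icc]
      exact fun x hx => (hg2 x hx).differentiableAt.differentiableWithinAt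
    · rw [interior_Icc]
      intro x hx
      have h := (hg2 x hx).deriv
      simp only [Function.iterate_succ, Function.iterate_zero, Function.comp, id]
      rw [h]
      linarith [hbM x hx]
  -- integrability of continuous functions of X
  have hint : ∀ g : ℝ → ℝ, ContinuousOn g (Set.Icc a b) → Integrable (fun ω => g (X ω)) ℙ := by
    intro g hg
    obtain ⟨C, hC⟩ := isCompact_Icc.exists_bound_of_continuousOn hg
    have hG : Continuous (Set.IccExtend hab ((Set.Icc a b).domRestrict g)) :=
      (continuousOn_iff_continuous_domRestrict.1 hg).Icc_extend'
    refine Integrable.of_bound (C := C) ?_ ?_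
    · refine ⟨fun ω => Set.IccExtend hab ((Set.Icc a b).domRestrict g) (X ω),
        (hG.measurable.comp hX).stronglyMeasurable, ?_⟩
      filter_upwards [hXab] with ω hω
      rw [Set.IccExtend_of_mem hab _ hω]; rfl
    · filter_upwards [hXab] with ω hω
      exact hC _ hω
  have hXi : Integrable X ℙ := hint (fun x => x) continuousOn_id
  have hX2 : Integrable (fun ω => X ω ^ 2) ℙ := hint (fun x => x ^ 2) (by fun_prop)
  have hfi := hint f hfc
  have hmean : (∫ ω, X ω) ∈ Set.Icc a b :=
    (convex_Icc a b).integral_mem isClosed_Icc hXab hXi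
  have hJ := hconv.map_integral_le hgc isClosed_Icc hXab hXi (hint _ hgc)
  have hI : (∫ ω, (f (X ω) - M / 2 * X ω ^ 2)) = (∫ ω, f (X ω)) - M / 2 * ∫ ω, X ω ^ 2 := by
    rw [integral_sub hfi (hX2.const_mul _), integral_const_mul]
  have hL2 : MemLp X 2 ℙ := (memLp_two_iff_integrable_sq hX.aestronglyMeasurable).2 hX2
  have hvar : variance X ℙ = (∫ ω, X ω ^ 2) - (∫ ω, X ω) ^ 2 := variance_eq_sub hL2
  refine ⟨?_, ?_⟩
  · refine intermediate_value_Icc hab hfc ?_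
    refine (convex_Icc (f a) (f b)).integral_mem isClosed_Icc ?_ hfi
    filter_upwards [hXab] with ω hω
    exact ⟨hmono.monotoneOn ⟨le_rfl, hab⟩ hω hω.1, hmono.monotoneOn hω ⟨hab, le_rfl⟩ hω.2⟩
  · intro y hy hfy
    have hv0 : 0 ≤ variance X ℙ := variance_nonneg X ℙ
    have hβ0 : 0 ≤ β := by rw [hβ]; positivity
    rcases le_total (∫ ω, X ω) y with h | h
    · have := mul_nonneg hβ0 hv0
      linarith
    · have hmvt := (convex_Icc a b).mul_sub_le_image_sub_of_le_deriv hfc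
        (by rw [interior_Icc]; exact fun x hx => (hd1 x hx).differentiableWithinAt)
        (fun x hx => hmle x (interior_subset hx)) y hy _ hmean h
      have hβm : β * m = -M := by
        rw [hβ, abs_of_nonpos hM0]; field_simp
      rw [hI] at hJ
      have hJ' : f (∫ ω, X ω) - M / 2 * (∫ ω, X ω) ^ 2
        ≤ (∫ ω, f (X ω)) - M / 2 * ∫ ω, X ω ^ 2 := hJ
      have h1 : m * ((∫ ω, X ω) - y) ≤ m * ((1 / 2) * β * variance X ℙ) := by
        have h2 : m * ((1 / 2) * β * variance X ℙ) = -M / 2 * variance X ℙ := by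
          rw [← hβm]; ring
        rw [h2, hvar]
        linarith
      have := le_of_mul_le_mul_left h1 hm0
      linarith
end

section
/- Let beta > 0 and define the exponential utility f(x) = (1/beta) * (1 - exp(-beta*x)), which is strictly increasing and concave on R. Let d > 0 and c be reals, let G be a random variable taking values in [G_min, G_max] almost surely, set Delta_G = G_max - G_min, let I = [d*c + d*G_min, d*c + d*G_max], and set beta_I = |inf_{z in I} f''(z)| / inf_{z in I} f'(z). Then the scaled certainty-equivalent value V = (1/d) * ( f^{-1}( E[ f(d*c + d*G) ] ) - d*c ) satisfies V >= E[G] - (d/8) * beta_I * Delta_G^2. -/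
open MeasureTheory ProbabilityTheory

/-- Lower bound for the scaled certainty-equivalent value function under exponential
utility `f(x) = (1/β)(1 - exp(-βx))`: with discount level `d > 0`, scaled stock `c`,
bounded return `G ∈ [Gmin, Gmax]` a.s., range `Δ_G = Gmax - Gmin`, interval
`I = [dc + d Gmin, dc + d Gmax]` and effective risk aversion
`β_I = |inf_I f''| / inf_I f'`, the value
`V = (1/d)(f⁻¹(E[f(dc + dG)]) - dc)` satisfies `V ≥ E[G] - (d/8) β_I Δ_G²`. -/
theorem entropic_value_lower_bound
    {Ω : Type*} [MeasureSpace Ω] [IsProbabilityMeasure (ℙ : Measure Ω)]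
    (β : ℝ) (hβ : 0 < β)
    (f : ℝ → ℝ) (hf : ∀ x, f x = (1 / β) * (1 - Real.exp (-β * x)))
    (d c : ℝ) (hd : 0 < d)
    (Gmin Gmax : ℝ) (hGmm : Gmin ≤ Gmax)
    (G : Ω → ℝ) (hG : Measurable G) (hGab : ∀ᵐ ω ∂ℙ, G ω ∈ Set.Icc Gmin Gmax)
    (ΔG : ℝ) (hΔ : ΔG = Gmax - Gmin)
    (I : Set ℝ) (hI : I = Set.Icc (d * c + d * Gmin) (d * c + d * Gmax))
    (βI : ℝ) (hβI : βI = |sInf (deriv (deriv f) '' I)| / sInf (deriv f '' I))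
    (V : ℝ)
    (hV : V = (1 / d) * (Function.invFun f (∫ ω, f (d * c + d * G ω)) - d * c)) :
    (∫ ω, G ω) - (d / 8) * βI * ΔG ^ 2 ≤ V := by
  have hfe : f = fun x => (1 / β) * (1 - Real.exp (-β * x)) := funext hf
  have hexp : ∀ x, HasDerivAt (fun x => Real.exp (-β * x)) (-β * Real.exp (-β * x)) x := by
    intro x
    have h := ((hasDerivAt_id x).const_mul (-β)).exp
    simp only [id, mul_one] at h
    rw [mul_comm]
    exact h
  have hd1 : deriv f = fun x => Real.exp (-β * x) := by
    funext x
    have h := (((hexp x).const_sub 1).const_mul (1 / β))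
    rw [hfe, h.deriv]
    field_simp
  have hd2 : deriv (deriv f) = fun x => -β * Real.exp (-β * x) := by
    rw [hd1]
    funext x
    exact (hexp x).deriv
  have hab : d * c + d * Gmin ≤ d * c + d * Gmax := by
    nlinarith
  have hinf1 : sInf (deriv f '' I) = Real.exp (-β * (d * c + d * Gmax)) := by
    apply IsLeast.csInf_eq
    rw [hd1, hI]
    refine ⟨⟨_, Set.right_mem_Icc.2 hab, rfl⟩, ?_⟩
    rintro _ ⟨x, hx, rfl⟩
    apply Real.exp_le_exp.2
    nlinarith [hx.2]
  have hinf2 : sInf (deriv (deriv f) '' I) = -β * Real.exp (-β * (d * c + d * Gmin)) := by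
    apply IsLeast.csInf_eq
    rw [hd2, hI]
    refine ⟨⟨_, Set.left_mem_Icc.2 hab, rfl⟩, ?_⟩
    rintro _ ⟨x, hx, rfl⟩
    have : Real.exp (-β * x) ≤ Real.exp (-β * (d * c + d * Gmin)) := by
      apply Real.exp_le_exp.2
      nlinarith [hx.1]
    show -β * Real.exp (-β * (d * c + d * Gmin)) ≤ -β * Real.exp (-β * x)
    nlinarith
  have hβle : β ≤ βI := by
    rw [hβI, hinf1, hinf2, le_div_iff₀ (Real.exp_pos _), abs_mul, abs_neg, abs_of_pos hβ,
      abs_of_pos (Real.exp_pos _)]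
    apply mul_le_mul_of_nonneg_left _ hβ.le
    apply Real.exp_le_exp.2
    nlinarith
  have hinj : Function.Injective f := by
    intro x y hxy
    rw [hf, hf] at hxy
    have h1 := mul_left_cancel₀ (by positivity : (1 / β) ≠ 0) hxy
    have h2 : Real.exp (-β * x) = Real.exp (-β * y) := by linarith
    have h3 := Real.exp_injective h2
    exact mul_left_cancel₀ (by linarith : -β ≠ 0) h3
  have hsub := hasSubgaussianMGF_of_mem_Icc (μ := (ℙ : Measure Ω)) hG.aemeasurable hGab
  set m := ∫ ω, G ω with hm
  have hInt := hsub.integrable_exp_mul (-β * d)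
  have hle := hsub.mgf_le (-β * d)
  have hpos := mgf_pos hInt
  set N := mgf (fun ω => G ω - m) ℙ (-β * d) with hN
  have hEq : ∀ ω, Real.exp (-β * (d * c + d * G ω))
      = Real.exp (-β * (d * c + d * m)) * Real.exp (-β * d * (G ω - m)) := by
    intro ω
    rw [← Real.exp_add]
    congr 1
    ring
  have hE : ∫ ω, f (d * c + d * G ω) = (1 / β) * (1 - Real.exp (-β * (d * c + d * m)) * N) := by
    simp only [hf, hEq]
    rw [integral_const_mul, integral_sub (integrable_const _) (hInt.const_mul _),
      integral_const_mul]
    simp [hN, mgf]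
  have hE2 : ∫ ω, f (d * c + d * G ω) = f (d * c + d * m - Real.log N / β) := by
    rw [hE, hf]
    congr 2
    rw [show -β * (d * c + d * m - Real.log N / β) = -β * (d * c + d * m) + Real.log N by
      field_simp; ring, Real.exp_add, Real.exp_log hpos]
  rw [hE2, Function.leftInverse_invFun hinj] at hV
  have hlog : Real.log N ≤ β ^ 2 * d ^ 2 * ΔG ^ 2 / 8 := by
    have h := Real.log_le_log hpos hle
    rw [Real.log_exp] at h
    refine h.trans (le_of_eq ?_)
    rw [hΔ]
    simp only [NNReal.coe_pow, NNReal.coe_div, coe_nnnorm, Real.norm_eq_abs, div_pow, sq_abs,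
      NNReal.coe_ofNat]
    ring
  have hV2 : V = m - Real.log N / (β * d) := by
    rw [hV]
    field_simp
    ring
  have h1 : Real.log N / (β * d) ≤ d / 8 * β * ΔG ^ 2 := by
    rw [div_le_iff₀ (by positivity)]
    nlinarith
  have h2 : d / 8 * β * ΔG ^ 2 ≤ d / 8 * βI * ΔG ^ 2 := by gcongr
  linarith
end

section
/- Let f : R -> R be twice continuously differentiable with |f''(x)| <= M for all x and some constant M >= 0, let a be a real number with f'(a) > 0, let d > 0, and let G be a bounded random variable. Then | ( E[ f(a + d*G) ] - f(a) ) / ( d * f'(a) ) - E[G] | <= M * d * E[G^2] / ( 2 * f'(a) ). -/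
open MeasureTheory ProbabilityTheory

lemma taylor_two_bound (f : ℝ → ℝ) (hf : ContDiff ℝ 2 f)
    (M : ℝ) (hM : ∀ x, |deriv (deriv f) x| ≤ M) (a x : ℝ) :
    |f x - f a - deriv f a * (x - a)| ≤ M * (x - a) ^ 2 / 2 := by
  rcases eq_or_ne a x with rfl | hx
  · simp
  obtain ⟨y, -, hy⟩ := taylor_mean_remainder_lagrange_iteratedDeriv (n := 1) hx
    (hf.contDiffOn (s := Set.uIcc a x))
  have hd : derivWithin f (Set.uIcc a x) a = deriv f a :=
    ((hf.differentiable (by norm_num)) a).derivWithin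
      ((uniqueDiffOn_uIcc hx) a Set.left_mem_uIcc)
  have h2 : iteratedDeriv 2 f y = deriv (deriv f) y := by
    rw [iteratedDeriv_succ, iteratedDeriv_one]
  have e : f x - f a - deriv f a * (x - a) = deriv (deriv f) y * (x - a) ^ 2 / 2 := by
    rw [← h2]
    have := hy
    simp [taylorWithinEval_succ, taylor_within_zero_eval, iteratedDerivWithin_one, hd] at this
    linarith
  rw [e, abs_div, abs_mul, abs_of_nonneg (sq_nonneg (x - a)), abs_of_pos (two_pos : (0:ℝ) < 2)]
  gcongr
  exact hM y

/-- The key estimate behind asymptotic risk-neutrality: for a twice continuously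
differentiable utility `f` with `|f''| ≤ M`, `f'(a) > 0` and `d > 0`, the normalized
expected-utility objective deviates from the risk-neutral objective `E[G]` by at most
`M d E[G²] / (2 f'(a))`. -/
theorem asymptotic_risk_neutrality_estimate
    {Ω : Type*} [MeasureSpace Ω] [IsProbabilityMeasure (ℙ : Measure Ω)]
    (f : ℝ → ℝ) (hf : ContDiff ℝ 2 f)
    (M : ℝ) (hM0 : 0 ≤ M) (hM : ∀ x, |deriv (deriv f) x| ≤ M)
    (a : ℝ) (ha : 0 < deriv f a)
    (d : ℝ) (hd : 0 < d)
    (G : Ω → ℝ) (hG : Measurable G) (B : ℝ) (hGb : ∀ᵐ ω ∂ℙ, |G ω| ≤ B) :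
    |((∫ ω, f (a + d * G ω)) - f a) / (d * deriv f a) - ∫ ω, G ω| ≤
      M * d * (∫ ω, (G ω) ^ 2) / (2 * deriv f a) := by
  have iG : Integrable G (ℙ : Measure Ω) :=
    Integrable.of_bound hG.aestronglyMeasurable B (by simpa using hGb)
  have iG2 : Integrable (fun ω => (G ω) ^ 2) (ℙ : Measure Ω) :=
    Integrable.of_bound (hG.pow_const 2).aestronglyMeasurable (B ^ 2) (by
      filter_upwards [hGb] with ω h
      rw [Real.norm_eq_abs, abs_pow]
      gcongr)
  have key : ∀ ω, |f (a + d * G ω) - f a - deriv f a * d * G ω| ≤ M * d ^ 2 / 2 * (G ω) ^ 2 := by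
    intro ω
    have := taylor_two_bound f hf M hM a (a + d * G ω)
    rw [add_sub_cancel_left] at this
    convert this using 2 <;> ring
  have iR : Integrable (fun ω => f (a + d * G ω) - f a - deriv f a * d * G ω) (ℙ : Measure Ω) := by
    refine (iG2.const_mul (M * d ^ 2 / 2)).mono' ?_ (Filter.Eventually.of_forall key)
    have := hf.continuous.measurable
    exact Measurable.aestronglyMeasurable (by fun_prop)
  have hR : |∫ ω, (f (a + d * G ω) - f a - deriv f a * d * G ω)| ≤
      M * d ^ 2 / 2 * ∫ ω, (G ω) ^ 2 := by
    rw [← integral_const_mul]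
    exact norm_integral_le_of_norm_le
      (f := fun ω => f (a + d * G ω) - f a - deriv f a * d * G ω) (iG2.const_mul _) (Filter.Eventually.of_forall key)
  have e : ∫ ω, f (a + d * G ω) =
      (∫ ω, (f (a + d * G ω) - f a - deriv f a * d * G ω)) + (f a + deriv f a * d * ∫ ω, G ω) := by
    have h1 : ∫ ω, (f a + deriv f a * d * G ω) = f a + deriv f a * d * ∫ ω, G ω := by
      rw [integral_add (integrable_const _) (iG.const_mul _), integral_const_mul]
      simp
    have i2 : Integrable (fun ω => f a + deriv f a * d * G ω) (ℙ : Measure Ω) :=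
      (integrable_const _).add (iG.const_mul _)
    rw [← h1, ← integral_add iR i2]
    congr 1
    ext ω
    ring
  rw [e]
  generalize (∫ ω, (f (a + d * G ω) - f a - deriv f a * d * G ω)) = R at *
  have e2 : (R + (f a + deriv f a * d * ∫ ω, G ω) - f a) / (d * deriv f a) - ∫ ω, G ω
      = R / (d * deriv f a) := by
    field_simp
    ring
  have e3 : M * d * (∫ ω, (G ω) ^ 2) / (2 * deriv f a) =
      (M * d ^ 2 / 2 * ∫ ω, (G ω) ^ 2) / (d * deriv f a) := by
    field_simp
  have hp : 0 < d * deriv f a := mul_pos hd ha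
  rw [e2, e3, abs_div, abs_of_pos hp]
  gcongr
end

section
/- Let kappa_2 > kappa_1 > 0 and define the Mean-CVaR utility f(x) = kappa_1 * max(x, 0) + kappa_2 * min(x, 0). Then f is a strictly increasing bijection from R to R, and for every integrable random variable X, with Lambda = (kappa_2 - kappa_1) / kappa_1, the certainty equivalent satisfies f^{-1}( E[ f(X) ] ) >= E[X] - Lambda * E[ -min(X, 0) ]. -/
open MeasureTheory ProbabilityTheory

/-- The Mean-CVaR utility `f(x) = κ₁ (x)₊ + κ₂ (x)₋` with `κ₂ > κ₁ > 0` is a strictly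
increasing bijection of `ℝ`, and its certainty equivalent satisfies
`f⁻¹(E[f(X)]) ≥ E[X] - Λ E[-(X)₋]` where `Λ = (κ₂ - κ₁)/κ₁`. -/
theorem meanCVaR_certainty_equivalent_lower_bound
    {Ω : Type*} [MeasureSpace Ω] [IsProbabilityMeasure (ℙ : Measure Ω)]
    (κ₁ κ₂ : ℝ) (hκ₁ : 0 < κ₁) (hκ : κ₁ < κ₂)
    (f : ℝ → ℝ) (hf : ∀ x, f x = κ₁ * max x 0 + κ₂ * min x 0)
    (Λ : ℝ) (hΛ : Λ = (κ₂ - κ₁) / κ₁) :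
    StrictMono f ∧ Function.Bijective f ∧
      ∀ X : Ω → ℝ, Integrable X →
        (∫ ω, X ω) - Λ * (∫ ω, -min (X ω) 0) ≤
          Function.invFun f (∫ ω, f (X ω)) := by
  have hf' : ∀ x, f x = κ₁ * x + (κ₂ - κ₁) * min x 0 := by
    intro x
    rw [hf]
    have := max_add_min x 0
    have h2 : max x 0 = x - min x 0 := by linarith
    rw [h2]; ring
  have hmono : StrictMono f := by
    intro x y hxy
    rw [hf', hf']
    have h1 : min x 0 ≤ min y 0 := min_le_min_right 0 hxy.le
    have h2 := mul_le_mul_of_nonneg_left h1 (sub_pos.2 hκ).le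
    have h3 := mul_lt_mul_of_pos_left hxy hκ₁
    linarith
  have hκ₂ : 0 < κ₂ := hκ₁.trans hκ
  have hsurj : Function.Surjective f := by
    intro y
    rcases le_total 0 y with hy | hy
    · refine ⟨y / κ₁, ?_⟩
      have : 0 ≤ y / κ₁ := by positivity
      rw [hf', min_eq_right this]
      field_simp
      ring
    · refine ⟨y / κ₂, ?_⟩
      have : y / κ₂ ≤ 0 := div_nonpos_of_nonpos_of_nonneg hy hκ₂.le
      rw [hf', min_eq_left this]
      field_simp
      ring
  refine ⟨hmono, ⟨hmono.injective, hsurj⟩, ?_⟩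
  intro X hX
  have hm : Integrable (fun ω => min (X ω) 0) := hX.inf (integrable_const (0 : ℝ))
  have hE : ∫ ω, f (X ω) = κ₁ * (∫ ω, X ω) + (κ₂ - κ₁) * ∫ ω, min (X ω) 0 := by
    simp_rw [hf']
    rw [integral_add (hX.const_mul _) (hm.const_mul _), integral_const_mul, integral_const_mul]
  have hinv : f (Function.invFun f (∫ ω, f (X ω))) = ∫ ω, f (X ω) :=
    Function.rightInverse_invFun hsurj _
  generalize Function.invFun f (∫ ω, f (X ω)) = y at hinv ⊢
  rw [hE, hf'] at hinv
  rw [integral_neg]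
  have h0 : (κ₂ - κ₁) * min y 0 ≤ 0 :=
    mul_nonpos_of_nonneg_of_nonpos (sub_pos.2 hκ).le (min_le_right _ _)
  have hL : κ₁ * Λ = κ₂ - κ₁ := by rw [hΛ]; field_simp
  refine le_of_mul_le_mul_left ?_ hκ₁
  rw [← hL] at hinv h0
  linarith
end

section
/- Let kappa_2 > kappa_1 > 0 and define the Mean-CVaR utility f(x) = kappa_1 * max(x, 0) + kappa_2 * min(x, 0), with Lambda = (kappa_2 - kappa_1) / kappa_1. Let d > 0 and c be reals and let G be an integrable random variable. Then the scaled certainty-equivalent value V = (1/d) * ( f^{-1}( E[ f(d*c + d*G) ] ) - d*c ) satisfies V >= E[G] - Lambda * E[ | min(c + G, 0) | ]. -/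
open MeasureTheory ProbabilityTheory

/-- Lower bound for the scaled certainty-equivalent value function under the Mean-CVaR
utility `f(x) = κ₁ (x)₊ + κ₂ (x)₋` with `κ₂ > κ₁ > 0` and loss-aversion coefficient
`Λ = (κ₂ - κ₁)/κ₁`: for `d > 0`, scaled stock `c` and integrable return `G`, the value
`V = (1/d)(f⁻¹(E[f(dc + dG)]) - dc)` satisfies `V ≥ E[G] - Λ E[|min(c + G, 0)|]`. -/
theorem meanCVaR_value_lower_bound
    {Ω : Type*} [MeasureSpace Ω] [IsProbabilityMeasure (ℙ : Measure Ω)]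
    (κ₁ κ₂ : ℝ) (hκ₁ : 0 < κ₁) (hκ : κ₁ < κ₂)
    (f : ℝ → ℝ) (hf : ∀ x, f x = κ₁ * max x 0 + κ₂ * min x 0)
    (Λ : ℝ) (hΛ : Λ = (κ₂ - κ₁) / κ₁)
    (d c : ℝ) (hd : 0 < d)
    (G : Ω → ℝ) (hG : Integrable G)
    (V : ℝ)
    (hV : V = (1 / d) * (Function.invFun f (∫ ω, f (d * c + d * G ω)) - d * c)) :
    (∫ ω, G ω) - Λ * (∫ ω, |min (c + G ω) 0|) ≤ V := by
  have hκ₂ : 0 < κ₂ := hκ₁.trans hκ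
  have hf' : ∀ x, f x = κ₁ * x + (κ₂ - κ₁) * min x 0 := by
    intro x
    rw [hf]
    rcases le_total x 0 with h | h
    · rw [max_eq_right h, min_eq_left h]; ring
    · rw [max_eq_left h, min_eq_right h]; ring
  have hsurj : Function.Surjective f := by
    intro y
    rcases le_total y 0 with h | h
    · refine ⟨y / κ₂, ?_⟩
      have h1 : y / κ₂ ≤ 0 := div_nonpos_of_nonpos_of_nonneg h hκ₂.le
      rw [hf, max_eq_right h1, min_eq_left h1]
      field_simp
      ring
    · refine ⟨y / κ₁, ?_⟩
      have h1 : 0 ≤ y / κ₁ := div_nonneg h hκ₁.le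
      rw [hf, max_eq_left h1, min_eq_right h1]
      field_simp
      ring
  have hcG : Integrable (fun ω => c + G ω) := (integrable_const c).add hG
  have hM : Integrable (fun ω => |min (c + G ω) 0|) :=
    (hcG.inf (integrable_const (0 : ℝ))).abs
  have hpt : ∀ ω, f (d * c + d * G ω)
      = κ₁ * d * (c + G ω) - (κ₂ - κ₁) * d * |min (c + G ω) 0| := by
    intro ω
    rw [hf', abs_of_nonpos (min_le_right _ _)]
    have : min (d * c + d * G ω) 0 = d * min (c + G ω) 0 := by
      rw [mul_min_of_nonneg _ _ hd.le, mul_zero, mul_add]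
    rw [this]; ring
  have hint : ∫ ω, f (d * c + d * G ω)
      = κ₁ * d * (c + ∫ ω, G ω) - (κ₂ - κ₁) * d * ∫ ω, |min (c + G ω) 0| := by
    simp_rw [hpt]
    rw [integral_sub (hcG.const_mul _) (hM.const_mul _), integral_const_mul,
      integral_const_mul, integral_add (integrable_const c) hG]
    simp
  have hu := Function.rightInverse_invFun hsurj (∫ ω, f (d * c + d * G ω))
  set u := Function.invFun f (∫ ω, f (d * c + d * G ω)) with hu_def
  rw [hint, hf'] at hu
  have hmin : (κ₂ - κ₁) * min u 0 ≤ 0 :=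
    mul_nonpos_of_nonneg_of_nonpos (sub_pos.2 hκ).le (min_le_right _ _)
  have hΛ' : κ₂ - κ₁ = κ₁ * Λ := by rw [hΛ]; field_simp
  have hVd : u = d * (V + c) := by rw [hV]; field_simp; ring
  set E := ∫ ω, G ω
  set M := ∫ ω, |min (c + G ω) 0|
  have key : κ₁ * d * (E - Λ * M) ≤ κ₁ * d * V := by
    have h1 : κ₁ * d * (c + E) - (κ₂ - κ₁) * d * M ≤ κ₁ * u := by linarith
    rw [hΛ', hVd] at h1
    linarith
  exact le_of_mul_le_mul_left key (mul_pos hκ₁ hd)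
end
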